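/- Let R be a commutative ring, let y₀ be a distinguished element and N a finite nonempty set with y₀ ∉ N, and set X = {y₀} ∪ N. Let S be a function assigning to each nonempty subset of X an element of R. Then the (1+|N|)-th order cumulant of S on X equals a sum over second-order cumulants: ∑_{P partition of X} (−1)^{|P|−1} (|P|−1)! ∏_{B ∈ P} S(B) = ∑_{∅ ≠ Z ⊆ N} ( S({y₀} ∪ Z) − S({y₀})·S(Z) ) · ∑_{Q partition of N \ Z} (−1)^{|Q|} |Q|! ∏_{B ∈ Q} S(B), where the sum on the right over partitions of the empty set (the case Z = N) is interpreted as the single empty partition contributing 1. -/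

import Mathlib

/-- The set of partitions of a finite set `X` into mutually disjoint nonempty blocks,
realized as a `Finset` of `Finset`s of blocks. -/
def partitionsOf {α : Type*} [DecidableEq α] (X : Finset α) : Finset (Finset (Finset α)) :=
  X.powerset.powerset.filter
    (fun P => (∀ B ∈ P, B.Nonempty) ∧
      (∀ B ∈ P, ∀ B' ∈ P, B ≠ B' → Disjoint B B') ∧ P.biUnion id = X)

theorem mem_partitionsOf {α : Type*} [DecidableEq α] {X : Finset α} {P : Finset (Finset α)} :
    P ∈ partitionsOf X ↔ (∀ B ∈ P, B.Nonempty) ∧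
      (∀ B ∈ P, ∀ B' ∈ P, B ≠ B' → Disjoint B B') ∧ P.biUnion id = X := by
  simp only [partitionsOf, Finset.mem_filter, Finset.mem_powerset, and_iff_right_iff_imp]
  rintro ⟨-, -, rfl⟩ B hB
  exact Finset.mem_powerset.2 (Finset.subset_biUnion_of_mem id hB)

theorem subset_of_mem_partitionsOf {α : Type*} [DecidableEq α] {X B : Finset α}
    {P : Finset (Finset α)} (hP : P ∈ partitionsOf X) (hB : B ∈ P) : B ⊆ X := by
  rw [← (mem_partitionsOf.1 hP).2.2]
  exact Finset.subset_biUnion_of_mem id hB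

theorem erase_mem_partitionsOf {α : Type*} [DecidableEq α] {X B : Finset α}
    {P : Finset (Finset α)} (hP : P ∈ partitionsOf X) (hB : B ∈ P) :
    P.erase B ∈ partitionsOf (X \ B) := by
  obtain ⟨hne, hdisj, rfl⟩ := mem_partitionsOf.1 hP
  refine mem_partitionsOf.2 ⟨fun C hC => hne C (Finset.mem_of_mem_erase hC),
    fun C hC D hD => hdisj C (Finset.mem_of_mem_erase hC) D (Finset.mem_of_mem_erase hD), ?_⟩
  ext x
  simp only [Finset.mem_biUnion, Finset.mem_erase, Finset.mem_sdiff, id]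
  constructor
  · rintro ⟨C, ⟨hCB, hC⟩, hx⟩
    exact ⟨⟨C, hC, hx⟩, Finset.disjoint_left.1 (hdisj C hC B hB hCB) hx⟩
  · rintro ⟨⟨C, hC, hx⟩, hxB⟩
    exact ⟨C, ⟨fun h => hxB (h ▸ hx), hC⟩, hx⟩

theorem notMem_of_mem_partitionsOf_sdiff {α : Type*} [DecidableEq α] {X B : Finset α}
    {Q : Finset (Finset α)} (hQ : Q ∈ partitionsOf (X \ B)) (hB : B.Nonempty) : B ∉ Q := by
  intro h
  obtain ⟨x, hx⟩ := hB
  exact (Finset.mem_sdiff.1 (subset_of_mem_partitionsOf hQ h hx)).2 hx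

theorem insert_mem_partitionsOf {α : Type*} [DecidableEq α] {X B : Finset α}
    {Q : Finset (Finset α)} (hQ : Q ∈ partitionsOf (X \ B)) (hB : B.Nonempty) (hBX : B ⊆ X) :
    insert B Q ∈ partitionsOf X := by
  have hBQ : ∀ C ∈ Q, Disjoint C B := fun C hC =>
    Finset.disjoint_of_subset_left (subset_of_mem_partitionsOf hQ hC) Finset.sdiff_disjoint
  obtain ⟨hne, hdisj, hU⟩ := mem_partitionsOf.1 hQ
  refine mem_partitionsOf.2 ⟨?_, ?_, ?_⟩
  · simpa [hB] using hne
  · intro C hC D hD hCD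
    rcases Finset.mem_insert.1 hC with rfl | hCQ <;> rcases Finset.mem_insert.1 hD with rfl | hDQ
    · exact absurd rfl hCD
    · exact (hBQ D hDQ).symm
    · exact hBQ C hCQ
    · exact hdisj C hCQ D hDQ hCD
  · rw [Finset.biUnion_insert, hU, id, Finset.union_sdiff_of_subset hBX]

/-- Summing over a partition with a marked block amounts to choosing the marked block first
and then a partition of its complement. -/
theorem sum_partitionsOf_sum_erase {α M : Type*} [DecidableEq α] [AddCommMonoid M]
    (X : Finset α) (f : Finset α → Finset (Finset α) → M) :
    ∑ P ∈ partitionsOf X, ∑ B ∈ P, f B (P.erase B) =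
      ∑ B ∈ X.powerset.filter (fun B => B.Nonempty), ∑ Q ∈ partitionsOf (X \ B), f B Q := by
  rw [Finset.sum_sigma', Finset.sum_sigma']
  refine Finset.sum_bij' (fun p _ => ⟨p.2, p.1.erase p.2⟩) (fun q _ => ⟨insert q.1 q.2, q.1⟩)
    ?_ ?_ ?_ ?_ ?_
  · rintro ⟨P, B⟩ h
    simp only [Finset.mem_sigma, Finset.mem_filter, Finset.mem_powerset] at h ⊢
    exact ⟨⟨subset_of_mem_partitionsOf h.1 h.2, (mem_partitionsOf.1 h.1).1 B h.2⟩,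
      erase_mem_partitionsOf h.1 h.2⟩
  · rintro ⟨B, Q⟩ h
    simp only [Finset.mem_sigma, Finset.mem_filter, Finset.mem_powerset] at h ⊢
    exact ⟨insert_mem_partitionsOf h.2 h.1.2 h.1.1, Finset.mem_insert_self _ _⟩
  · rintro ⟨P, B⟩ h
    simp only [Finset.mem_sigma] at h
    simp [Finset.insert_erase h.2]
  · rintro ⟨B, Q⟩ h
    simp only [Finset.mem_sigma, Finset.mem_filter, Finset.mem_powerset] at h
    simp [Finset.erase_insert (notMem_of_mem_partitionsOf_sdiff h.2 h.1.2)]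
  · rintro ⟨P, B⟩ h
    rfl

/-- The signed factorial sum over partitions: with `S ∅` replaced by `1`, it is the inverse of `S`
under convolution of set functions. -/
def signedPartitionSum {α R : Type*} [DecidableEq α] [CommRing R] (S : Finset α → R)
    (X : Finset α) : R :=
  ∑ Q ∈ partitionsOf X, (-1 : R) ^ Q.card * (Nat.factorial Q.card : R) * ∏ B ∈ Q, S B

theorem nonempty_of_mem_partitionsOf {α : Type*} [DecidableEq α] {X : Finset α}
    {P : Finset (Finset α)} (hP : P ∈ partitionsOf X) (hX : X.Nonempty) : P.Nonempty := by
  rw [← (mem_partitionsOf.1 hP).2.2] at hX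
  obtain ⟨x, hx⟩ := hX
  obtain ⟨B, hB, -⟩ := Finset.mem_biUnion.1 hx
  exact ⟨B, hB⟩

theorem signedPartitionSum_eq_neg_sum {α R : Type*} [DecidableEq α] [CommRing R]
    (S : Finset α → R) {X : Finset α} (hX : X.Nonempty) :
    signedPartitionSum S X =
      -∑ Z ∈ X.powerset.filter (fun Z => Z.Nonempty), S Z * signedPartitionSum S (X \ Z) := by
  simp only [signedPartitionSum, Finset.mul_sum]
  rw [← sum_partitionsOf_sum_erase X
    (fun B Q => S B * ((-1 : R) ^ Q.card * (Nat.factorial Q.card : R) * ∏ B ∈ Q, S B)),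
    ← Finset.sum_neg_distrib]
  refine Finset.sum_congr rfl fun P hP => ?_
  obtain ⟨k, hk⟩ := Nat.exists_eq_succ_of_ne_zero
    (nonempty_of_mem_partitionsOf hP hX).card_pos.ne'
  have hterm : ∀ B ∈ P, S B * ((-1 : R) ^ (P.erase B).card *
      (Nat.factorial (P.erase B).card : R) * ∏ C ∈ P.erase B, S C) =
      (-1 : R) ^ k * (Nat.factorial k : R) * ∏ C ∈ P, S C := by
    intro B hB
    rw [Finset.card_erase_of_mem hB, hk, ← Finset.mul_prod_erase P S hB, Nat.succ_sub_one]
    ring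
  rw [Finset.sum_congr rfl hterm, Finset.sum_const, hk, nsmul_eq_mul, Nat.factorial_succ, pow_succ]
  push_cast
  ring

/-- The cumulant on `insert y N`, expanded along the block containing `y`. -/
theorem cumulant_insert_eq_sum {α R : Type*} [DecidableEq α] [CommRing R]
    (S : Finset α → R) {y : α} {N : Finset α} (hy : y ∉ N) :
    (∑ P ∈ partitionsOf (insert y N),
        (-1 : R) ^ (P.card - 1) * (Nat.factorial (P.card - 1) : R) * ∏ B ∈ P, S B) =
      ∑ Z ∈ N.powerset, S (insert y Z) * signedPartitionSum S (N \ Z) := by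
  have hmark : ∀ P ∈ partitionsOf (insert y N),
      (-1 : R) ^ (P.card - 1) * (Nat.factorial (P.card - 1) : R) * ∏ B ∈ P, S B =
      ∑ B ∈ P, if y ∈ B then S B * ((-1 : R) ^ (P.erase B).card *
        (Nat.factorial (P.erase B).card : R) * ∏ C ∈ P.erase B, S C) else 0 := by
    intro P hP
    obtain ⟨-, hdisj, hU⟩ := mem_partitionsOf.1 hP
    obtain ⟨B, hB, hyB⟩ := Finset.mem_biUnion.1 (hU ▸ Finset.mem_insert_self y N)
    rw [id] at hyB
    rw [Finset.sum_eq_single_of_mem B hB, if_pos hyB, Finset.card_erase_of_mem hB,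
      ← Finset.mul_prod_erase P S hB]
    · ring
    · exact fun C hC hCB => if_neg fun hyC =>
        Finset.disjoint_left.1 (hdisj C hC B hB hCB) hyC hyB
  rw [Finset.sum_congr rfl hmark, sum_partitionsOf_sum_erase (insert y N)
    (fun B Q => if y ∈ B then
      S B * ((-1 : R) ^ Q.card * (Nat.factorial Q.card : R) * ∏ C ∈ Q, S C) else 0),
    Finset.sum_filter, Finset.sum_powerset_insert hy, Finset.sum_eq_zero, zero_add]
  · refine Finset.sum_congr rfl fun Z hZ => ?_
    have hsdiff : insert y N \ insert y Z = N \ Z := by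
      rw [Finset.insert_sdiff_insert, Finset.sdiff_insert_of_notMem hy]
    simp [hsdiff, signedPartitionSum, Finset.mul_sum]
  · intro Z hZ
    have hyZ : y ∉ Z := fun h => hy (Finset.mem_powerset.1 hZ h)
    simp [hyZ]

/-- Lemma 1 of the paper: the cumulant of order `1 + |N|` on `X = {y₀} ∪ N` is expressed
through first and second order cumulants. -/
theorem cumulant_eq_sum_second_order_cumulants
    {α R : Type*} [DecidableEq α] [CommRing R]
    (y₀ : α) (N : Finset α) (hN : N.Nonempty) (hy₀ : y₀ ∉ N)
    (S : Finset α → R) :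
    (∑ P ∈ partitionsOf (insert y₀ N),
        (-1 : R) ^ (P.card - 1) * (Nat.factorial (P.card - 1) : R) * ∏ B ∈ P, S B)
    = ∑ Z ∈ N.powerset.filter (fun Z => Z.Nonempty),
        (S (insert y₀ Z) - S {y₀} * S Z) *
          ∑ Q ∈ partitionsOf (N \ Z),
            (-1 : R) ^ Q.card * (Nat.factorial Q.card : R) * ∏ B ∈ Q, S B := by
  have hempty : N.powerset.filter (fun Z => ¬ Z.Nonempty) = {∅} := by
    ext Z
    simp +contextual [Finset.not_nonempty_iff_eq_empty]
  rw [cumulant_insert_eq_sum S hy₀,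
    ← Finset.sum_filter_add_sum_filter_not N.powerset (fun Z => Z.Nonempty), hempty,
    Finset.sum_singleton, Finset.sdiff_empty, signedPartitionSum_eq_neg_sum S hN,
    insert_empty_eq, mul_neg, Finset.mul_sum, ← sub_eq_add_neg, ← Finset.sum_sub_distrib]
  refine Finset.sum_congr rfl fun Z _ => ?_
  rw [← signedPartitionSum]
  ring
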